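/- There exists a constant c > 0 depending only on the dimension n such that the following holds. Let T > 0, M > 0 and let u be a smooth positive solution of the heat equation on ℝⁿ × (0, T] with u ≤ M everywhere. Then for every x ∈ ℝⁿ and every t ∈ (0, T], one has |∇u(x,t)|/u(x,t) ≤ c t^{-1/2} (1 + ln(M/u(x,t))). (Global-in-space version of estimate (1.4) obtained by letting R → ∞.) -/

import Mathlib

open Metric Set

/-- Spatial gradient of a function on Euclidean space. -/
noncomputable def sgrad {n : ℕ} (f : EuclideanSpace ℝ (Fin n) → ℝ)
    (x : EuclideanSpace ℝ (Fin n)) : EuclideanSpace ℝ (Fin n) :=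
  gradient f x

/-- Spatial Laplacian: sum of the second partial derivatives. -/
noncomputable def slap {n : ℕ} (f : EuclideanSpace ℝ (Fin n) → ℝ)
    (x : EuclideanSpace ℝ (Fin n)) : ℝ :=
  ∑ i : Fin n, fderiv ℝ (fun y => fderiv ℝ f y (EuclideanSpace.single i 1)) x
    (EuclideanSpace.single i 1)

/-- `u(x,t)` is a (smooth) solution of the heat equation on `Q`. -/
def IsHeatSolutionOn {n : ℕ} (u : EuclideanSpace ℝ (Fin n) → ℝ → ℝ)
    (Q : Set (EuclideanSpace ℝ (Fin n) × ℝ)) : Prop :=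
  ContDiffOn ℝ (⊤ : ℕ∞) (fun p : EuclideanSpace ℝ (Fin n) × ℝ => u p.1 p.2) Q ∧
  ∀ p ∈ Q, deriv (fun s => u p.1 s) p.2 = slap (fun y => u y p.2) p.1

open scoped ContDiff

lemma HasDerivAt.nonpos_of_forall_Ioo_le {g : ℝ → ℝ} {g' a b : ℝ} (hab : a < b)
    (hg : HasDerivAt g g' a) (h : ∀ r ∈ Ioo a b, g r ≤ g a) : g' ≤ 0 := by
  have h1 := (hasDerivAt_iff_tendsto_slope.1 hg).mono_left
    (nhdsWithin_mono a (show Ioi a ⊆ {a}ᶜ from fun r hr => (ne_of_gt hr)))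
  refine le_of_tendsto h1 ?_
  filter_upwards [Ioo_mem_nhdsGT hab] with r hr
  rw [slope_def_field]
  exact div_nonpos_of_nonpos_of_nonneg (by linarith [h r hr]) (by linarith [hr.1])

lemma HasDerivAt.nonneg_of_forall_Ioo_le {g : ℝ → ℝ} {g' a b : ℝ} (hab : b < a)
    (hg : HasDerivAt g g' a) (h : ∀ r ∈ Ioo b a, g r ≤ g a) : 0 ≤ g' := by
  have h1 := (hasDerivAt_iff_tendsto_slope.1 hg).mono_left
    (nhdsWithin_mono a (show Iio a ⊆ {a}ᶜ from fun r hr => (ne_of_lt hr)))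
  refine ge_of_tendsto h1 ?_
  filter_upwards [Ioo_mem_nhdsLT hab] with r hr
  rw [slope_def_field]
  exact div_nonneg_of_nonpos (by linarith [h r hr]) (by linarith [hr.2])

lemma IsLocalMax.second_deriv_nonpos {g g' : ℝ → ℝ} {g'' a : ℝ} (hmax : IsLocalMax g a)
    (hg : ∀ r, HasDerivAt g (g' r) r) (hg' : HasDerivAt g' g'' a) : g'' ≤ 0 := by
  by_contra! hpos
  have hd : deriv g = g' := funext fun r => (hg r).deriv
  have hmin : IsLocalMin g a := isLocalMin_of_deriv_deriv_pos
    (by rwa [hd, hg'.deriv]) hmax.deriv_eq_zero (hg a).continuousAt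
  have hconst : g =ᶠ[nhds a] fun _ => g a := by
    filter_upwards [hmax, hmin] with r h1 h2 using le_antisymm h1 h2
  have h0 : g' =ᶠ[nhds a] fun _ => 0 := by
    have := hconst.deriv
    rw [hd] at this
    simpa using this
  have := h0.deriv_eq
  rw [hg'.deriv] at this
  simp at this
  linarith

lemma ContDiff.hasDerivAt_line {E : Type*} [NormedAddCommGroup E] [NormedSpace ℝ E] {φ : E → ℝ}
    (hφ : ContDiff ℝ ∞ φ) (x e : E) (r : ℝ) :
    HasDerivAt (fun τ : ℝ => φ (x + τ • e)) (fderiv ℝ φ (x + r • e) e) r := by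
  have h1 : HasDerivAt (fun τ : ℝ => x + τ • e) e r := by
    simpa using ((hasDerivAt_id r).smul_const e).const_add x
  exact ((hφ.differentiable (by simp)) _).hasFDerivAt.comp_hasDerivAt r h1

lemma ContDiff.fderiv_apply_const {E : Type*} [NormedAddCommGroup E] [NormedSpace ℝ E]
    {φ : E → ℝ} (hφ : ContDiff ℝ ∞ φ) (e : E) : ContDiff ℝ ∞ (fun y => fderiv ℝ φ y e) :=
  (hφ.fderiv_right (m := ∞) (by simp)).clm_apply contDiff_const

lemma mul_sq_sub_sq_sub_mul_le {p a b e v : ℝ} (hp : 1 < p) (h : p * b - a - e = 0) :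
    p * b ^ 2 - a ^ 2 - v * a ≤ p / (2 * (p - 1)) * v ^ 2 + (2 * p / (p - 1) + 1) * e ^ 2 := by
  obtain ⟨q, rfl⟩ : ∃ q, p = q + 1 := ⟨p - 1, by ring⟩
  have hq : 0 < q := by linarith
  obtain rfl : a = (q + 1) * b - e := by linarith
  have hq1 : q + 1 - 1 = q := by ring
  rw [hq1, ← sub_nonneg]
  have key : (q + 1) / (2 * q) * v ^ 2 + (2 * (q + 1) / q + 1) * e ^ 2 -
      ((q + 1) * b ^ 2 - ((q + 1) * b - e) ^ 2 - v * ((q + 1) * b - e))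
      = q / (q + 1) * ((q + 1) * b - e + ((q + 1) * v - 2 * e) / (2 * q)) ^ 2
        + (q + 1) / (4 * q) * (v + 2 * e / (q + 1)) ^ 2 + (3 * q + 4) / (q + 1) * e ^ 2 := by
    field_simp
    ring
  rw [key]
  positivity

lemma clm_apply_eq_sum {n : ℕ} (L : EuclideanSpace ℝ (Fin n) →L[ℝ] ℝ) (v : EuclideanSpace ℝ (Fin n)) :
    L v = ∑ i, v i * L (EuclideanSpace.single i 1) := by
  conv_lhs => rw [← (EuclideanSpace.basisFun (Fin n) ℝ).sum_repr v]
  simp [map_sum]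

/-- First and second order conditions in direction `i` at a spatial maximum. -/
lemma coordinate_conditions {n : ℕ} {φ ψ : EuclideanSpace ℝ (Fin n) → ℝ} (hφ : ContDiff ℝ ∞ φ)
    (hψ : ContDiff ℝ ∞ ψ) (hφ0 : ∀ x, 0 < φ x) (hψ0 : ∀ x, 0 < ψ x) {p η k : ℝ}
    {x y z : EuclideanSpace ℝ (Fin n)}
    (hmax : IsLocalMax (fun ξ => p * Real.log (φ ξ) - Real.log (ψ (ξ + y)) - η * ‖ξ - z‖ ^ 2 - k) x)
    (i : Fin n) :
    p * (fderiv ℝ φ x (EuclideanSpace.single i 1) / φ x)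
        - fderiv ℝ ψ (x + y) (EuclideanSpace.single i 1) / ψ (x + y) - 2 * η * (x - z) i = 0 ∧
      p * (fderiv ℝ (fun ξ => fderiv ℝ φ ξ (EuclideanSpace.single i 1)) x
            (EuclideanSpace.single i 1) / φ x
          - (fderiv ℝ φ x (EuclideanSpace.single i 1) / φ x) ^ 2)
        - (fderiv ℝ (fun ξ => fderiv ℝ ψ ξ (EuclideanSpace.single i 1)) (x + y)
            (EuclideanSpace.single i 1) / ψ (x + y)
          - (fderiv ℝ ψ (x + y) (EuclideanSpace.single i 1) / ψ (x + y)) ^ 2) - 2 * η ≤ 0 := by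
  set e : EuclideanSpace ℝ (Fin n) := EuclideanSpace.single i 1 with he
  let g : ℝ → ℝ := fun τ => p * Real.log (φ (x + τ • e)) - Real.log (ψ (x + y + τ • e))
    - η * (‖x - z‖ ^ 2 + 2 * τ * (x - z) i + τ ^ 2) - k
  let g' : ℝ → ℝ := fun τ => p * (fderiv ℝ φ (x + τ • e) e / φ (x + τ • e))
    - fderiv ℝ ψ (x + y + τ • e) e / ψ (x + y + τ • e) - η * (2 * (x - z) i + 2 * τ)
  have hgmax : IsLocalMax g 0 := by
    have hc : Filter.Tendsto (fun τ : ℝ => x + τ • e) (nhds 0) (nhds x) := by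
      have : Continuous (fun τ : ℝ => x + τ • e) := by fun_prop
      simpa using this.tendsto 0
    filter_upwards [hc.eventually hmax] with τ hτ
    have hn : ‖x + τ • e - z‖ ^ 2 = ‖x - z‖ ^ 2 + 2 * τ * (x - z) i + τ ^ 2 := by
      rw [show x + τ • e - z = (x - z) + τ • e by abel, norm_add_sq_real, inner_smul_right, norm_smul,
        he, EuclideanSpace.inner_single_right]
      simp
      ring
    simp only [hn] at hτ
    simp only [g]
    rw [show x + y + τ • e = x + τ • e + y by abel]
    simpa using hτ
  have hg : ∀ τ, HasDerivAt g (g' τ) τ := by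
    intro τ
    have h1 := (((hφ.hasDerivAt_line x e τ).log (hφ0 _).ne').const_mul p)
    have h2 := (hψ.hasDerivAt_line (x + y) e τ).log (hψ0 _).ne'
    have h3 : HasDerivAt (fun τ : ℝ => ‖x - z‖ ^ 2 + 2 * τ * (x - z) i + τ ^ 2)
        (2 * (x - z) i + 2 * τ) τ := by
      have := ((((hasDerivAt_id τ).const_mul 2).mul_const ((x - z) i)).const_add
        (‖x - z‖ ^ 2)).add ((hasDerivAt_id τ).pow 2)
      exact this.congr_deriv (by simp)
    exact ((h1.sub h2).sub (h3.const_mul η)).sub_const k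
  have hg' : HasDerivAt g' (p * (fderiv ℝ (fun ξ => fderiv ℝ φ ξ e) x e / φ x
          - (fderiv ℝ φ x e / φ x) ^ 2)
        - (fderiv ℝ (fun ξ => fderiv ℝ ψ ξ e) (x + y) e / ψ (x + y)
          - (fderiv ℝ ψ (x + y) e / ψ (x + y)) ^ 2) - 2 * η) 0 := by
    have h1 := (((hφ.fderiv_apply_const e).hasDerivAt_line x e 0).div
      (hφ.hasDerivAt_line x e 0) (hφ0 _).ne').const_mul p
    have h2 := ((hψ.fderiv_apply_const e).hasDerivAt_line (x + y) e 0).div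
      (hψ.hasDerivAt_line (x + y) e 0) (hψ0 _).ne'
    have h3 : HasDerivAt (fun τ : ℝ => 2 * (x - z) i + 2 * τ) 2 0 := by
      simpa using ((hasDerivAt_id (0 : ℝ)).const_mul 2).const_add (2 * (x - z) i)
    refine ((h1.sub h2).sub (h3.const_mul η)).congr_deriv ?_
    simp only [zero_smul, add_zero]
    have := (hφ0 x).ne'
    have := (hψ0 (x + y)).ne'
    field_simp
  refine ⟨?_, hgmax.second_deriv_nonpos hg hg'⟩
  have h0 := hgmax.hasDerivAt_eq_zero (hg 0)
  simp only [g', zero_smul, add_zero, mul_zero] at h0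
  linarith

lemma contDiff_slice {E : Type*} [NormedAddCommGroup E] [NormedSpace ℝ E] {w : E → ℝ → ℝ} {t : ℝ}
    (hw : ∀ x, ContDiffAt ℝ ∞ (fun q : E × ℝ => w q.1 q.2) (x, t)) :
    ContDiff ℝ ∞ (fun x => w x t) :=
  contDiff_iff_contDiffAt.2 fun x =>
    (hw x).comp x (f := fun y : E => (y, t)) (contDiffAt_id.prodMk contDiffAt_const)

/-- Time derivative along a point moving with constant velocity `v`. -/
lemma hasDerivAt_moving {E : Type*} [NormedAddCommGroup E] [NormedSpace ℝ E] {w : E → ℝ → ℝ}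
    {x v : E} {δ t : ℝ}
    (hw : ContDiffAt ℝ ∞ (fun q : E × ℝ => w q.1 q.2) (x + (t - δ) • v, t)) :
    HasDerivAt (fun s => w (x + (s - δ) • v) s)
      (deriv (fun s => w (x + (t - δ) • v) s) t
        + fderiv ℝ (fun y => w y t) (x + (t - δ) • v) v) t := by
  set y := x + (t - δ) • v
  have hd := (hw.differentiableAt (by simp)).hasFDerivAt
  set L := fderiv ℝ (fun q : E × ℝ => w q.1 q.2) (y, t)
  have h1 : HasDerivAt (fun s : ℝ => (x + (s - δ) • v, s)) (v, (1 : ℝ)) t := by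
    refine HasDerivAt.prodMk ?_ (hasDerivAt_id t)
    simpa using (((hasDerivAt_id t).sub_const δ).smul_const v).const_add x
  have h2 : HasDerivAt (fun s : ℝ => w y s) (L (0, 1)) t :=
    hd.comp_hasDerivAt t ((hasDerivAt_const t y).prodMk (hasDerivAt_id t))
  have h3 : HasFDerivAt (fun ξ : E => w ξ t) (L.comp (ContinuousLinearMap.inl ℝ E ℝ)) y :=
    hd.comp y (f := fun ξ : E => (ξ, t)) (hasFDerivAt_prodMk_left y t)
  rw [h2.deriv, h3.fderiv]
  have h4 := HasFDerivAt.comp_hasDerivAt (f := fun s : ℝ => (x + (s - δ) • v, s)) t hd h1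
  refine h4.congr_deriv ?_
  simp [← map_add]

/-- Dimension-free Harnack inequality for solutions of the heat equation with `ε ≤ w ≤ M`. The
maximum principle is applied to `p log w(x, s) - log w(x + (s - δ) v, s)`, where `v` is the constant
velocity moving `z` to `z + h` during `[δ, t]`. -/
lemma log_harnack {n : ℕ} {w : EuclideanSpace ℝ (Fin n) → ℝ → ℝ} {T M ε : ℝ} (hε : 0 < ε)
    (hw : ∀ x, ∀ t ∈ Ioo 0 T, ContDiffAt ℝ ∞ (fun q : _ × ℝ => w q.1 q.2) (x, t))
    (heat : ∀ x, ∀ t ∈ Ioo 0 T, deriv (fun s => w x s) t = slap (fun y => w y t) x)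
    (hlow : ∀ x, ∀ t ∈ Ioo 0 T, ε ≤ w x t) (hup : ∀ x, ∀ t ∈ Ioo 0 T, w x t ≤ M)
    {p : ℝ} (hp : 1 < p) {δ t : ℝ} (hδ : 0 < δ) (hδt : δ < t) (htT : t < T)
    (z h : EuclideanSpace ℝ (Fin n)) :
    p * Real.log (w z t) - Real.log (w (z + h) t) - (p - 1) * Real.log M
      ≤ p / (2 * (p - 1)) * (‖h‖ ^ 2 / (t - δ)) := by
  have hdt : 0 < t - δ := sub_pos.2 hδt
  have hp1 : 0 < p - 1 := sub_pos.2 hp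
  have hpos : ∀ x, ∀ s ∈ Ioo 0 T, 0 < w x s := fun x s hs => hε.trans_le (hlow x s hs)
  have hsub : ∀ s ∈ Icc δ t, s ∈ Ioo 0 T := fun s hs =>
    ⟨hδ.trans_le hs.1, hs.2.trans_lt htT⟩
  have hεM : ε ≤ M := (hlow z t (hsub t ⟨hδt.le, le_rfl⟩)).trans (hup z t (hsub t ⟨hδt.le, le_rfl⟩))
  set v : EuclideanSpace ℝ (Fin n) := (t - δ)⁻¹ • h with hv
  set K : ℝ := p / (2 * (p - 1)) * ‖v‖ ^ 2 with hK
  have hvh : (t - δ) • v = h := by rw [hv, smul_smul, mul_inv_cancel₀ hdt.ne', one_smul]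
  have hKt : p / (2 * (p - 1)) * (‖h‖ ^ 2 / (t - δ)) = K * (t - δ) := by
    rw [hK, hv, norm_smul, Real.norm_eq_abs, abs_of_pos (inv_pos.2 hdt)]
    field_simp
  set B : ℝ := Real.log M - Real.log ε with hB
  have hB0 : 0 ≤ B := sub_nonneg.2 (Real.log_le_log hε hεM)
  set C : ℝ := 2 * p / (p - 1) + 1 with hC
  have hC0 : 0 < C := by positivity
  rw [hKt]
  refine le_of_forall_pos_le_add fun σ' hσ' => ?_
  obtain ⟨σ, hσ, hσeq⟩ : ∃ σ : ℝ, 0 < σ ∧ σ * (t - δ) = σ' :=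
    ⟨σ' / (t - δ), by positivity, by field_simp⟩
  obtain ⟨η, hη, hησ⟩ : ∃ η : ℝ, 0 < η ∧ η * (2 * n + 4 * C * B) < σ := by
    have hD : 0 < 2 * n + 4 * C * B + 1 := by positivity
    refine ⟨σ / (2 * n + 4 * C * B + 1), by positivity, ?_⟩
    rw [div_mul_eq_mul_div, div_lt_iff₀ hD]
    nlinarith
  rw [← hσeq, ← add_mul]
  by_contra! hcon
  let H : EuclideanSpace ℝ (Fin n) → ℝ → ℝ := fun x s =>
    p * Real.log (w x s) - Real.log (w (x + (s - δ) • v) s) - η * ‖x - z‖ ^ 2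
      - ((p - 1) * Real.log M + (K + σ) * (s - δ))
  have hHz : 0 < H z t := by
    simp only [H, sub_self, norm_zero, hvh]
    linarith
  have hK0 : 0 ≤ K := by positivity
  have hHle : ∀ x, ∀ s ∈ Icc δ t, H x s ≤ B - η * ‖x - z‖ ^ 2 := by
    intro x s hs
    have h1 := Real.log_le_log (hpos x s (hsub s hs)) (hup x s (hsub s hs))
    have h2 := Real.log_le_log hε (hlow (x + (s - δ) • v) s (hsub s hs))
    have h3 : 0 ≤ (K + σ) * (s - δ) := mul_nonneg (by positivity) (sub_nonneg.2 hs.1)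
    simp only [H]
    nlinarith
  have hcont : ContinuousOn (fun q : EuclideanSpace ℝ (Fin n) × ℝ => H q.1 q.2)
      (closedBall z (Real.sqrt (B / η)) ×ˢ Icc δ t) := by
    intro q hq
    have hq2 := hsub q.2 hq.2
    have c1 : ContinuousAt (fun q : EuclideanSpace ℝ (Fin n) × ℝ => w q.1 q.2) q :=
      (hw q.1 q.2 hq2).continuousAt
    have c2 : ContinuousAt
        (fun q : EuclideanSpace ℝ (Fin n) × ℝ => w (q.1 + (q.2 - δ) • v) q.2) q :=
      ContinuousAt.comp (g := fun q : EuclideanSpace ℝ (Fin n) × ℝ => w q.1 q.2)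
        (f := fun q : EuclideanSpace ℝ (Fin n) × ℝ => (q.1 + (q.2 - δ) • v, q.2))
        (hw _ _ hq2).continuousAt (by fun_prop)
    have c3 := c1.log (hpos _ _ hq2).ne'
    have c4 := c2.log (hpos _ _ hq2).ne'
    refine ContinuousAt.continuousWithinAt ?_
    exact (((c3.const_mul p).sub c4).sub (by fun_prop)).sub (by fun_prop)
  obtain ⟨⟨x, s⟩, ⟨hx, hs⟩, hmax⟩ := ((isCompact_closedBall z _).prod isCompact_Icc).exists_isMaxOn
    ⟨(z, t), mem_closedBall_self (Real.sqrt_nonneg _), right_mem_Icc.2 hδt.le⟩ hcont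
  have hmax' : ∀ x' ∈ closedBall z (Real.sqrt (B / η)), ∀ s' ∈ Icc δ t, H x' s' ≤ H x s :=
    fun x' hx' s' hs' => hmax (⟨hx', hs'⟩ : (x', s') ∈ _ ×ˢ _)
  have hHpos : 0 < H x s := hHz.trans_le
    (hmax' z (mem_closedBall_self (Real.sqrt_nonneg _)) t (right_mem_Icc.2 hδt.le))
  simp only at hx hs
  have hs0 := hsub s hs
  have hxB : η * ‖x - z‖ ^ 2 < B := by linarith [hHle x s hs]
  have hxball : x ∈ ball z (Real.sqrt (B / η)) := by
    rw [mem_ball, dist_eq_norm]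
    apply Real.lt_sqrt_of_sq_lt
    rw [lt_div_iff₀ hη]
    linarith
  have hδs : δ < s := by
    refine lt_of_le_of_ne hs.1 fun hEq => ?_
    subst hEq
    have h1 := Real.log_le_log (hpos x δ hs0) (hup x δ hs0)
    have h2 : 0 ≤ η * ‖x - z‖ ^ 2 := by positivity
    simp only [H, sub_self, zero_smul, add_zero, mul_zero] at hHpos
    nlinarith
  have hspace : IsLocalMax (fun ξ => H ξ s) x := by
    filter_upwards [isOpen_ball.mem_nhds hxball] with ξ hξ
    exact hmax' ξ (ball_subset_closedBall hξ) s hs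
  have hφ : ContDiff ℝ ∞ (fun y => w y s) := contDiff_slice fun y => hw y s hs0
  have hco := coordinate_conditions hφ hφ (fun y => hpos y s hs0) (fun y => hpos y s hs0) hspace
  set y := x + (s - δ) • v with hy
  have htime : 0 ≤ p * (deriv (fun s => w x s) s / w x s)
      - (deriv (fun s => w y s) s + fderiv ℝ (fun ξ => w ξ s) y v) / w y s - (K + σ) := by
    have h1 : HasDerivAt (fun r => w x r) (deriv (fun r => w x r) s) s := by
      simpa using hasDerivAt_moving (x := x) (v := 0) (δ := δ) (by simpa using hw x s hs0)
    have h2 := hasDerivAt_moving (x := x) (v := v) (δ := δ) (hw y s hs0)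
    have h3 : HasDerivAt (fun r => (p - 1) * Real.log M + (K + σ) * (r - δ)) (K + σ) s := by
      simpa using (((hasDerivAt_id s).sub_const δ).const_mul (K + σ)).const_add
        ((p - 1) * Real.log M)
    have h4 : HasDerivAt (fun r => H x r) _ s :=
      ((((h1.log (hpos x s hs0).ne').const_mul p).sub
        (h2.log (hpos y s hs0).ne')).sub_const (η * ‖x - z‖ ^ 2)).sub h3
    exact h4.nonneg_of_forall_Ioo_le hδs
      fun r hr => hmax' x hx r ⟨hr.1.le, hr.2.le.trans hs.2⟩
  rw [heat x s hs0, heat y s hs0, clm_apply_eq_sum (fderiv ℝ (fun ξ => w ξ s) y) v] at htime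
  simp only [slap] at htime
  have hsum : p * ((∑ i, fderiv ℝ (fun ξ => fderiv ℝ (fun ξ => w ξ s) ξ
          (EuclideanSpace.single i 1)) x (EuclideanSpace.single i 1)) / w x s)
      - ((∑ i, fderiv ℝ (fun ξ => fderiv ℝ (fun ξ => w ξ s) ξ
          (EuclideanSpace.single i 1)) y (EuclideanSpace.single i 1))
        + ∑ i, v i * fderiv ℝ (fun ξ => w ξ s) y (EuclideanSpace.single i 1)) / w y s
      ≤ ∑ i, (p / (2 * (p - 1)) * v i ^ 2 + C * (2 * η * (x - z) i) ^ 2 + 2 * η) := by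
    rw [← Finset.sum_add_distrib, Finset.sum_div, Finset.sum_div, Finset.mul_sum,
      ← Finset.sum_sub_distrib]
    refine Finset.sum_le_sum fun i _ => ?_
    obtain ⟨hi1, hi2⟩ := hco i
    have hi3 := mul_sq_sub_sq_sub_mul_le (v := v i) hp hi1
    rw [add_div, mul_div_assoc]
    simp only at hi1 hi2 hi3
    linarith
  have hsum2 : ∑ i, (p / (2 * (p - 1)) * v i ^ 2 + C * (2 * η * (x - z) i) ^ 2 + 2 * η)
      = K + 4 * C * η * (η * ‖x - z‖ ^ 2) + 2 * η * n := by
    simp only [Finset.sum_add_distrib, mul_pow, ← Finset.mul_sum, hK,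
      EuclideanSpace.real_norm_sq_eq, Finset.sum_const, Finset.card_univ, Fintype.card_fin,
      nsmul_eq_mul]
    ring
  rw [hsum2] at hsum
  have hfin : 4 * C * η * (η * ‖x - z‖ ^ 2) ≤ 4 * C * η * B :=
    mul_le_mul_of_nonneg_left hxB.le (by positivity)
  linarith

/-- Infinitesimal form of a Harnack inequality with quadratic cost. -/
lemma fderiv_le_of_log_harnack {E : Type*} [NormedAddCommGroup E] [NormedSpace ℝ E] {f : E → ℝ}
    {x : E} {M κ : ℝ} (hκ : 0 < κ) (hf : DifferentiableAt ℝ f x) (hpos : 0 < f x)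
    (hM : 0 < M)
    (hh : ∀ p : ℝ, 1 < p → ∀ h : E, p * Real.log (f x) - Real.log (f (x + h))
      - (p - 1) * Real.log M ≤ p / (p - 1) * (‖h‖ ^ 2 / κ ^ 2)) (e : E) (he : ‖e‖ = 1) :
    fderiv ℝ f x e / f x ≤ 1 / κ * (1 + Real.log (M / f x)) := by
  set F := Real.log M - Real.log (f x) with hF
  rw [Real.log_div hM.ne' hpos.ne', ← hF]
  have h1 : HasDerivAt (fun r : ℝ => x + r • (-e)) (-e) 0 := by
    simpa using ((hasDerivAt_id (0 : ℝ)).smul_const (-e)).const_add x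
  have h2 : HasDerivAt (fun r : ℝ => f (x + r • (-e))) (fderiv ℝ f x (-e)) 0 := by
    have h0 : HasFDerivAt f (fderiv ℝ f x) (x + (0 : ℝ) • (-e)) := by simpa using hf.hasFDerivAt
    exact h0.comp_hasDerivAt (0 : ℝ) h1
  have h3 := (h2.log (by simpa using hpos.ne')).neg
  have h4 : HasDerivAt (fun r : ℝ => r / κ * (1 + F) + (r / κ) ^ 2) (1 / κ * (1 + F)) 0 := by
    have := (((hasDerivAt_id (0 : ℝ)).div_const κ).mul_const (1 + F)).add
      (((hasDerivAt_id (0 : ℝ)).div_const κ).pow 2)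
    exact this.congr_deriv (by simp)
  have h5 := (h3.sub h4).nonpos_of_forall_Ioo_le one_pos fun r hr => ?_
  · simp only [zero_smul, add_zero, map_neg, neg_div, neg_neg] at h5
    linarith
  · have hr0 : 0 < r := hr.1
    have := hh (1 + r / κ) (by linarith [div_pos hr0 hκ]) (r • (-e))
    rw [norm_smul, norm_neg, he, Real.norm_eq_abs, abs_of_pos hr0, mul_one] at this
    have h6 : (1 + r / κ) / (1 + r / κ - 1) * (r ^ 2 / κ ^ 2) = r / κ + (r / κ) ^ 2 := by
      rw [add_sub_cancel_left]
      field_simp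
    rw [h6] at this
    simp only [Pi.sub_apply, Pi.neg_apply, zero_smul, add_zero, zero_div]
    rw [hF]
    linarith

lemma norm_gradient_le {E : Type*} [NormedAddCommGroup E] [InnerProductSpace ℝ E] [CompleteSpace E]
    {f : E → ℝ} {x : E} {A : ℝ} (hA : 0 ≤ A) (h : ∀ e : E, ‖e‖ = 1 → fderiv ℝ f x e ≤ A) :
    ‖gradient f x‖ ≤ A := by
  rcases eq_or_ne (gradient f x) 0 with h0 | h0
  · simpa [h0] using hA
  · have h1 := h ((‖gradient f x‖)⁻¹ • gradient f x) (by simp [norm_smul, h0])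
    rw [← inner_gradient_left, inner_smul_right, real_inner_self_eq_norm_sq] at h1
    have := norm_ne_zero_iff.2 h0
    field_simp at h1
    exact h1

/-- Harnack inequality up to and including the final time. -/
lemma log_harnack_Ioc {n : ℕ} {w : EuclideanSpace ℝ (Fin n) → ℝ → ℝ} {T M ε : ℝ} (hε : 0 < ε)
    (hw : ContDiffOn ℝ ∞ (fun q : EuclideanSpace ℝ (Fin n) × ℝ => w q.1 q.2) (univ ×ˢ Ioc 0 T))
    (heat : ∀ x, ∀ t ∈ Ioo 0 T, deriv (fun s => w x s) t = slap (fun y => w y t) x)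
    (hlow : ∀ x, ∀ t ∈ Ioc 0 T, ε ≤ w x t) (hup : ∀ x, ∀ t ∈ Ioc 0 T, w x t ≤ M)
    {p : ℝ} (hp : 1 < p) {t : ℝ} (ht : t ∈ Ioc 0 T) (z h : EuclideanSpace ℝ (Fin n)) :
    p * Real.log (w z t) - Real.log (w (z + h) t) - (p - 1) * Real.log M
      ≤ p / (p - 1) * (‖h‖ ^ 2 / t) := by
  have hp1 : 0 < p - 1 := sub_pos.2 hp
  have hlt : ∀ s ∈ Ioo 0 T, p * Real.log (w z s) - Real.log (w (z + h) s)
      - (p - 1) * Real.log M ≤ p / (p - 1) * (‖h‖ ^ 2 / s) := by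
    intro s hs
    have hs0 : 0 < s := hs.1
    have key := log_harnack hε
      (fun x r hr => hw.contDiffAt (prod_mem_nhds Filter.univ_mem
        (Filter.mem_of_superset (Ioo_mem_nhds hr.1 hr.2) Ioo_subset_Ioc_self))) heat
      (fun x r hr => hlow x r (Ioo_subset_Ioc_self hr))
      (fun x r hr => hup x r (Ioo_subset_Ioc_self hr)) hp (half_pos hs0) (half_lt_self hs0) hs.2 z h
    refine key.trans (le_of_eq ?_)
    field_simp
    ring
  have hcont : ∀ y, ContinuousOn (fun s => Real.log (w y s)) (Ioc 0 T) := fun y =>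
    (hw.continuousOn.comp (f := fun s : ℝ => (y, s)) (by fun_prop)
      fun s hs => ⟨mem_univ _, hs⟩).log fun s hs => (hε.trans_le (hlow y s hs)).ne'
  have hT : 0 < T := ht.1.trans_le ht.2
  have hcl : Ioc 0 T ⊆ closure (Ioo 0 T) := by
    rw [closure_Ioo hT.ne]
    exact Ioc_subset_Icc_self
  refine ContinuousWithinAt.closure_le (hcl ht) ?_ ?_ hlt
  · exact ((((hcont z).const_mul p).sub (hcont (z + h))).sub continuousOn_const t ht).mono
      Ioo_subset_Ioc_self
  · exact (continuousAt_const.mul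
      (continuousAt_const.div continuousAt_id ht.1.ne')).continuousWithinAt

/-- Global-in-space version of estimate (1.4). -/
theorem gradient_estimate_global (n : ℕ) (hn : 1 ≤ n) :
    ∃ c : ℝ, 0 < c ∧
      ∀ (T M : ℝ), 0 < T → 0 < M →
      ∀ u : EuclideanSpace ℝ (Fin n) → ℝ → ℝ,
        IsHeatSolutionOn u (univ ×ˢ Ioc 0 T) →
        (∀ (x : EuclideanSpace ℝ (Fin n)), ∀ t ∈ Ioc (0:ℝ) T, 0 < u x t ∧ u x t ≤ M) →
        ∀ (x : EuclideanSpace ℝ (Fin n)), ∀ t ∈ Ioc (0:ℝ) T,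
          ‖sgrad (fun y => u y t) x‖ / u x t ≤
            c / Real.sqrt t * (1 + Real.log (M / u x t)) := by
  refine ⟨2, two_pos, fun T M _ hM u ⟨hu, heat⟩ hb x t ht => ?_⟩
  -- Adding the constant `u x t` gives a solution bounded away from zero.
  set ε := u x t with hεdef
  have hε : 0 < ε := (hb x t ht).1
  have hεM : ε ≤ M := (hb x t ht).2
  have hsqrt : 0 < Real.sqrt t := Real.sqrt_pos.2 ht.1
  have hharnack := fun (p : ℝ) (hp : 1 < p) (h : EuclideanSpace ℝ (Fin n)) =>
    log_harnack_Ioc (w := fun y s => u y s + ε) (M := M + ε) hε (hu.add contDiffOn_const)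
      (fun y s hs => by
        simpa [slap] using heat (y, s) ⟨mem_univ _, Ioo_subset_Ioc_self hs⟩)
      (fun y s hs => by linarith [(hb y s hs).1]) (fun y s hs => by linarith [(hb y s hs).2])
      hp ht x h
  have hslice : DifferentiableAt ℝ (fun y => u y t) x := by
    have hc : ContDiff ℝ ∞ (fun y => u y t) :=
      contDiffOn_univ.1 (hu.comp (f := fun y => (y, t)) (by fun_prop) fun y _ => ⟨mem_univ _, ht⟩)
    exact hc.differentiable (by simp) x
  have hlog : Real.log ((M + ε) / (ε + ε)) ≤ Real.log (M / ε) := by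
    refine Real.log_le_log (by positivity) ?_
    rw [div_le_div_iff₀ (by positivity) hε]
    nlinarith
  have hlog0 : 0 ≤ Real.log (M / ε) := Real.log_nonneg ((one_le_div hε).2 hεM)
  rw [div_le_iff₀ hε]
  refine norm_gradient_le (by positivity) fun e he => ?_
  have key := fderiv_le_of_log_harnack (f := fun y => u y t + ε) (M := M + ε) hsqrt
    (hslice.add_const ε) (by positivity) (by positivity)
    (fun p hp h => by simpa [Real.sq_sqrt ht.1.le] using hharnack p hp h) e he
  rw [fderiv_add_const, ← hεdef, div_le_iff₀ (by positivity)] at key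
  refine key.trans ?_
  have : 1 / Real.sqrt t * (1 + Real.log ((M + ε) / (ε + ε))) * (ε + ε)
      ≤ 1 / Real.sqrt t * (1 + Real.log (M / ε)) * (ε + ε) := by gcongr
  refine this.trans (le_of_eq ?_)
  ring
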